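/- Let A be an associative unital algebra over the field ℚ(v), let F ∈ A, and let x, y ∈ A. If x satisfies the l-th order Serre relation with F, then for every integer n ≥ 0 and every m ≥ l+1, one has the vanishing of the bracketed expression appearing in the Serre-order additivity proof: for all 0 ≤ t ≤ b where y satisfies the b-th order Serre relation with F and x satisfies the a-th order Serre relation with F, (−1)^{1+a+b−t} F^{(1+a+b−t)} x + Σ_{s=0}^{a} (−1)^{a+b+t−s} binom(b+s−t, s) F^{(a−s)} x F^{(b+1+s−t)} = 0. -/

import Mathlib

/-- The quantum integer `[n] = (v^n - v^{-n})/(v - v^{-1})` in `ℚ(v)`. -/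
noncomputable def qint (n : ℤ) : RatFunc ℚ :=
  (RatFunc.X ^ n - RatFunc.X ^ (-n)) / (RatFunc.X - RatFunc.X⁻¹)

/-- The quantum factorial `[n]! = [n][n-1]⋯[1]`, with `[0]! = 1`. -/
noncomputable def qfact (n : ℕ) : RatFunc ℚ :=
  ∏ i ∈ Finset.range n, qint (i + 1)

/-- The quantum binomial coefficient `binom(n, k) = [n][n-1]⋯[n-k+1]/[k]!`
for `n : ℤ` and `k : ℕ`. -/
noncomputable def qbinom (n : ℤ) (k : ℕ) : RatFunc ℚ :=
  (∏ i ∈ Finset.range k, qint (n - i)) / qfact k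

/-- The `n`-th divided power `F^{(n)} = (1/[n]!) F^n` of an element `F`
of a `ℚ(v)`-algebra. -/
noncomputable def dpow {A : Type*} [Ring A] [Algebra (RatFunc ℚ) A]
    (F : A) (n : ℕ) : A :=
  (qfact n)⁻¹ • F ^ n

/-- `x` satisfies the `a`-th order Serre relation with `F`:
`Σ_{t=0}^{a+1} (-1)^{a+1-t} F^{(a+1-t)} x F^{(t)} = 0`. -/
def SerreRel {A : Type*} [Ring A] [Algebra (RatFunc ℚ) A]
    (F x : A) (a : ℕ) : Prop :=
  ∑ t ∈ Finset.range (a + 2),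
      ((-1 : RatFunc ℚ) ^ (a + 1 - t)) • (dpow F (a + 1 - t) * x * dpow F t) = 0


theorem ratX_pow_ne_one (k : ℕ) (hk : k ≠ 0) : (RatFunc.X : RatFunc ℚ) ^ k ≠ 1 := by
  intro h
  rw [← RatFunc.algebraMap_X, ← map_pow, ← map_one (algebraMap (Polynomial ℚ) (RatFunc ℚ))] at h
  have h2 := RatFunc.algebraMap_injective ℚ h
  have h3 := congrArg Polynomial.natDegree h2
  simp at h3
  exact hk h3

theorem ratX_den_ne : (RatFunc.X : RatFunc ℚ) - RatFunc.X⁻¹ ≠ 0 := by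
  intro h
  have hX : (RatFunc.X : RatFunc ℚ) ≠ 0 := RatFunc.X_ne_zero
  apply ratX_pow_ne_one 2 (by norm_num)
  have := sub_eq_zero.mp h
  rw [pow_two]
  nth_rewrite 2 [this]
  exact mul_inv_cancel₀ hX

theorem qint_ne_zero (n : ℕ) : qint ((n : ℤ) + 1) ≠ 0 := by
  have hX : (RatFunc.X : RatFunc ℚ) ≠ 0 := RatFunc.X_ne_zero
  unfold qint
  refine div_ne_zero ?_ ratX_den_ne
  intro h
  have h1 := sub_eq_zero.mp h
  apply ratX_pow_ne_one (2 * (n + 1)) (by omega)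
  rw [zpow_neg] at h1
  have e : (RatFunc.X : RatFunc ℚ) ^ ((n : ℤ) + 1) = RatFunc.X ^ (n + 1) := by
    exact_mod_cast zpow_natCast (RatFunc.X : RatFunc ℚ) (n + 1)
  rw [e] at h1
  rw [two_mul, pow_add]
  nth_rewrite 2 [h1]
  exact mul_inv_cancel₀ (pow_ne_zero _ hX)

theorem qint_zero : qint 0 = 0 := by simp [qint]

theorem qfact_ne_zero (n : ℕ) : qfact n ≠ 0 :=
  Finset.prod_ne_zero_iff.mpr fun i _ => qint_ne_zero i

theorem qfact_succ (n : ℕ) : qfact (n + 1) = qfact n * qint ((n : ℤ) + 1) := by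
  simp [qfact, Finset.prod_range_succ]

theorem qfact_zero : qfact 0 = 1 := by simp [qfact]

theorem qbinom_eq (m s : ℕ) :
    qbinom ((m : ℤ) + s) s = qfact (m + s) / (qfact m * qfact s) := by
  have key : ∀ s : ℕ, (∏ i ∈ Finset.range s, qint ((m : ℤ) + s - i)) * qfact m
      = qfact (m + s) := by
    intro s
    induction s with
    | zero => simp
    | succ k ih =>
      rw [Finset.prod_range_succ', ← add_assoc, qfact_succ, ← ih]
      have : ∀ i ∈ Finset.range k, qint ((m : ℤ) + ((k + 1 : ℕ) : ℤ) - ((i + 1 : ℕ) : ℤ))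
          = qint ((m : ℤ) + k - i) := by
        intro i _
        congr 1
        push_cast
        ring
      rw [Finset.prod_congr rfl this]
      have e : (m : ℤ) + ((k + 1 : ℕ) : ℤ) - ((0 : ℕ) : ℤ) = ((m + k : ℕ) : ℤ) + 1 := by
        push_cast
        ring
      rw [e]
      ring
  unfold qbinom
  rw [← key s]
  have h1 := qfact_ne_zero m
  have h2 := qfact_ne_zero s
  field_simp

/-- The quantum integer identity `[p+q][r+q] = [p][r] + [p+q+r][q]`. -/
theorem qint_identity (p q r : ℤ) :
    qint (p + q) * qint (r + q) = qint p * qint r + qint (p + q + r) * qint q := by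
  have hX : (RatFunc.X : RatFunc ℚ) ≠ 0 := RatFunc.X_ne_zero
  have hd := ratX_den_ne
  unfold qint
  simp only [div_mul_div_comm, ← add_div]
  congr 1
  simp only [neg_add, zpow_add₀ hX, zpow_neg]
  have h1 : (RatFunc.X : RatFunc ℚ) ^ p ≠ 0 := zpow_ne_zero _ hX
  have h2 : (RatFunc.X : RatFunc ℚ) ^ q ≠ 0 := zpow_ne_zero _ hX
  have h3 : (RatFunc.X : RatFunc ℚ) ^ r ≠ 0 := zpow_ne_zero _ hX
  generalize (RatFunc.X : RatFunc ℚ) ^ p = P at *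
  generalize (RatFunc.X : RatFunc ℚ) ^ q = Q at *
  generalize (RatFunc.X : RatFunc ℚ) ^ r = R at *
  field_simp
  ring

section
variable {A : Type*} [Ring A] [Algebra (RatFunc ℚ) A]

theorem mul_dpow (F : A) (n : ℕ) : F * dpow F n = qint ((n : ℤ) + 1) • dpow F (n + 1) := by
  unfold dpow
  rw [mul_smul_comm, smul_smul, qfact_succ, ← pow_succ']
  congr 1
  have h1 := qfact_ne_zero n
  have h2 := qint_ne_zero n
  field_simp

theorem dpow_mul (F : A) (m n : ℕ) :
    dpow F m * dpow F n = (qfact (m + n) / (qfact m * qfact n)) • dpow F (m + n) := by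
  unfold dpow
  rw [smul_mul_smul_comm, smul_smul, ← pow_add]
  congr 1
  have h1 := qfact_ne_zero m
  have h2 := qfact_ne_zero n
  have h3 := qfact_ne_zero (m + n)
  field_simp

theorem serre_zero (F x : A) (a : ℕ) (hx : SerreRel F x a) :
    dpow F (a + 1) * x = ∑ s ∈ Finset.range (a + 1),
      ((-1 : RatFunc ℚ) ^ s) • (dpow F (a - s) * x * dpow F (s + 1)) := by
  unfold SerreRel at hx
  rw [Finset.sum_range_succ'] at hx
  have h0 : dpow F 0 = 1 := by simp [dpow, qfact_zero]
  have h1 := congrArg (fun z => ((-1 : RatFunc ℚ) ^ (a + 1)) • z) hx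
  simp only [smul_add, Finset.smul_sum, smul_smul, Nat.sub_zero, h0, mul_one, smul_zero] at h1
  rw [← mul_pow] at h1
  simp only [mul_neg, mul_one, neg_neg, one_pow, one_smul] at h1
  rw [add_comm, ← eq_neg_iff_add_eq_zero, ← Finset.sum_neg_distrib] at h1
  rw [h1]
  refine Finset.sum_congr rfl fun s hs => ?_
  have hs' : s ≤ a := by simpa [Nat.lt_succ_iff] using hs
  obtain ⟨k, rfl⟩ := Nat.exists_eq_add_of_le hs'
  have e1 : s + k + 1 - (s + 1) = k := by omega
  have e2 : s + k - s = k := by omega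
  rw [e1, e2, ← neg_smul]
  congr 1
  have : ((-1 : RatFunc ℚ) ^ k) * (-1) ^ k = 1 := by rw [← mul_pow]; simp
  rw [pow_succ, pow_add]
  linear_combination ((-1 : RatFunc ℚ) ^ s) * this

theorem serre_core (F x : A) (a : ℕ) (hx : SerreRel F x a) (m : ℕ) :
    dpow F (a + 1 + m) * x = ∑ s ∈ Finset.range (a + 1),
      ((-1 : RatFunc ℚ) ^ s * (qfact (m + s) / (qfact m * qfact s))) •
        (dpow F (a - s) * x * dpow F (m + 1 + s)) := by
  induction m with
  | zero =>
    rw [add_zero, serre_zero F x a hx]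
    refine Finset.sum_congr rfl fun s _ => ?_
    have h := qfact_ne_zero s
    rw [zero_add, zero_add, qfact_zero, one_mul, div_self h, mul_one, add_comm 1 s]
  | succ m ih =>
    have hq := qint_ne_zero (a + 1 + m)
    have h1 := congrArg (fun z => F * z) ih
    simp only [← mul_assoc, mul_dpow, Finset.mul_sum, mul_smul_comm] at h1
    simp only [smul_mul_assoc, smul_smul] at h1
    -- split off the top term and reindex
    have h2 : ∑ s ∈ Finset.range (a + 1),
        ((-1 : RatFunc ℚ) ^ s * (qfact (m + s) / (qfact m * qfact s)) *
          qint (((a - s : ℕ) : ℤ) + 1)) • (dpow F (a - s + 1) * x * dpow F (m + 1 + s))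
        = (∑ s ∈ Finset.range (a + 1),
          ((-1 : RatFunc ℚ) ^ (s + 1) * (qfact (m + (s + 1)) / (qfact m * qfact (s + 1))) *
          qint ((a - s : ℕ) : ℤ)) • (dpow F (a - s) * x * dpow F (m + 1 + (s + 1))))
          + qint ((a : ℤ) + 1) • (dpow F (a + 1) * x * dpow F (m + 1)) := by
      rw [Finset.sum_range_succ', Finset.sum_range_succ (n := a)]
      congr 1
      · rw [Nat.sub_self, Nat.cast_zero, qint_zero, mul_zero, zero_smul, add_zero]
        refine Finset.sum_congr rfl fun s hs => ?_
        have hs' : s < a := by simpa using hs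
        have e : a - (s + 1) + 1 = a - s := by omega
        have e' : ((a - (s + 1) : ℕ) : ℤ) + 1 = ((a - s : ℕ) : ℤ) := by omega
        rw [e, e']
      · have h := qfact_ne_zero m
        simp [qfact_zero, div_self h]
    rw [h2, serre_zero F x a hx, Finset.sum_mul, Finset.smul_sum, ← Finset.sum_add_distrib] at h1
    have e0 : a + 1 + (m + 1) = a + 1 + m + 1 := by ring
    rw [e0]
    rw [← smul_right_injective A hq |>.eq_iff]
    rw [h1, Finset.smul_sum]
    refine Finset.sum_congr rfl fun s hs => ?_
    have hs' : s ≤ a := by simpa [Nat.lt_succ_iff] using hs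
    obtain ⟨k, rfl⟩ := Nat.exists_eq_add_of_le hs'
    have e2 : s + k - s = k := by omega
    rw [e2, smul_mul_assoc, mul_assoc _ (dpow F (s + 1)), dpow_mul, mul_smul_comm,
      smul_smul, smul_smul, smul_smul]
    have e3 : s + 1 + (m + 1) = m + s + 1 + 1 := by ring
    have e4 : m + 1 + (s + 1) = m + s + 1 + 1 := by ring
    have e5 : m + 1 + 1 + s = m + s + 1 + 1 := by ring
    have e6 : m + (s + 1) = m + s + 1 := by ring
    have e7 : m + 1 + s = m + s + 1 := by ring
    rw [e3, e4, e5, e6, e7, ← add_smul]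
    congr 1
    have f1 := qfact_ne_zero m
    have f2 := qfact_ne_zero s
    have f4 := qint_ne_zero m
    have f5 := qint_ne_zero s
    have id := qint_identity k ((s : ℤ) + 1) ((m : ℤ) + 1)
    have g1 : (((s + k : ℕ) : ℤ) + 1) = k + (s + 1) := by push_cast; ring
    have g2 : (((m + s + 1 : ℕ) : ℤ) + 1) = (m + 1) + (s + 1) := by push_cast; ring
    have g3 : (((s + k + 1 + m : ℕ) : ℤ) + 1) = k + (s + 1) + (m + 1) := by push_cast; ring
    rw [qfact_succ (m + s + 1), qfact_succ m, qfact_succ s, g1, g2, g3, pow_succ]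
    field_simp
    linear_combination qfact (m + s + 1) * id

end

/-- If `x` satisfies the `a`-th order Serre relation with `F` and `y` satisfies the
`b`-th order Serre relation with `F`, then for all `0 ≤ t ≤ b` the bracketed
expression appearing in the Serre-order additivity proof vanishes:
`(-1)^{1+a+b-t} F^{(1+a+b-t)} x
  + Σ_{s=0}^{a} (-1)^{a+b+t-s} binom(b+s-t, s) F^{(a-s)} x F^{(b+1+s-t)} = 0`. -/
theorem serre_bracket_vanishes {A : Type*} [Ring A] [Algebra (RatFunc ℚ) A]
    (F x y : A) (a b : ℕ) (hx : SerreRel F x a) (hy : SerreRel F y b) :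
    ∀ t : ℕ, t ≤ b →
      ((-1 : RatFunc ℚ) ^ (1 + a + b - t)) • (dpow F (1 + a + b - t) * x)
        + ∑ s ∈ Finset.range (a + 1),
            ((-1 : RatFunc ℚ) ^ (a + b + t - s) * qbinom ((b : ℤ) + s - t) s) •
              (dpow F (a - s) * x * dpow F (b + 1 + s - t)) = 0 := by
  intro t ht
  obtain ⟨m, rfl⟩ := Nat.exists_eq_add_of_le ht
  have e1 : 1 + a + (t + m) - t = a + 1 + m := by omega
  rw [e1, serre_core F x a hx m, Finset.smul_sum, ← Finset.sum_add_distrib]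
  refine Finset.sum_eq_zero fun s hs => ?_
  have hs' : s ≤ a := by simpa [Nat.lt_succ_iff] using hs
  obtain ⟨k, rfl⟩ := Nat.exists_eq_add_of_le hs'
  have e2 : s + k + (t + m) + t - s = k + m + 2 * t := by omega
  have e3 : t + m + 1 + s - t = m + 1 + s := by omega
  have e4 : ((t + m : ℕ) : ℤ) + s - t = (m : ℤ) + s := by push_cast; ring
  rw [e2, e3, e4, qbinom_eq, smul_smul, ← add_smul]
  convert zero_smul (RatFunc ℚ) _ using 2
  have h1 : ((-1 : RatFunc ℚ) ^ s) * (-1) ^ s = 1 := by rw [← mul_pow]; simp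
  have h2 : (-1 : RatFunc ℚ) ^ (2 * t) = 1 := by rw [pow_mul]; simp
  rw [pow_add _ (k + m), h2, pow_add, pow_add, pow_add, pow_add]
  linear_combination (-(-1 : RatFunc ℚ) ^ k * (-1) ^ m * (qfact (m + s) / (qfact m * qfact s))) * h1
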